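/- Let M be a finite monoid in DA, let s ∈ M, and let φ : Σ* → M be a monoid homomorphism from the free monoid over a finite alphabet Σ. Then for all finite words u, v ∈ Σ* with alph(u) = alph(v): if s R s·φ(u), then s R s·φ(v). -/

import Mathlib

open scoped Classical

/-! ## Generalized words -/

structure GWord (A : Type) : Type 1 where
  P : Type
  ord : LinearOrder P
  w : P → A

namespace GWord

variable {A : Type}

instance (u : GWord A) : LinearOrder u.P := u.ord

/-- The set of letters occurring in a generalized word. -/
def alph (u : GWord A) : Set A := Set.range u.w

/-- Restriction of a generalized word to a set of positions. -/
def restrict (u : GWord A) (s : Set u.P) : GWord A :=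
  ⟨{ p // p ∈ s }, inferInstance, fun p => u.w p.1⟩

/-- `p` is the first `a`-labelled position of `u`. -/
def IsFirst (u : GWord A) (a : A) (p : u.P) : Prop :=
  u.w p = a ∧ ∀ q : u.P, u.w q = a → p ≤ q

/-- `p` is the last `a`-labelled position of `u`. -/
def IsLast (u : GWord A) (a : A) (p : u.P) : Prop :=
  u.w p = a ∧ ∀ q : u.P, u.w q = a → q ≤ p

/-- The factor strictly before the first occurrence of `a`. -/
noncomputable def XL (u : GWord A) (a : A) : GWord A :=
  if h : ∃ p, u.IsFirst a p then u.restrict {q | q < h.choose} else u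

/-- The factor strictly after the first occurrence of `a`. -/
noncomputable def XR (u : GWord A) (a : A) : GWord A :=
  if h : ∃ p, u.IsFirst a p then u.restrict {q | h.choose < q} else u

/-- The factor strictly before the last occurrence of `a`. -/
noncomputable def YL (u : GWord A) (a : A) : GWord A :=
  if h : ∃ p, u.IsLast a p then u.restrict {q | q < h.choose} else u

/-- The factor strictly after the last occurrence of `a`. -/
noncomputable def YR (u : GWord A) (a : A) : GWord A :=
  if h : ∃ p, u.IsLast a p then u.restrict {q | h.choose < q} else u

/-- `C_{a,b}` is defined iff the first `a` is strictly to the right of the last `b`. -/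
def CDefined (u : GWord A) (a b : A) : Prop :=
  ∃ p q, u.IsFirst a p ∧ u.IsLast b q ∧ q < p

/-- The factor strictly between the last `b` and the first `a` (junk value if undefined). -/
noncomputable def Cab (u : GWord A) (a b : A) : GWord A :=
  if h : u.CDefined a b then
    u.restrict {r | h.choose_spec.choose < r ∧ r < h.choose}
  else u

/-- Accessibility: first/last occurrences of letters after/before every position exist. -/
def Accessible (u : GWord A) : Prop :=
  (∀ a : A, (∃ p, u.w p = a) → ∃ p, u.IsFirst a p) ∧
  (∀ a : A, (∃ p, u.w p = a) → ∃ p, u.IsLast a p) ∧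
  (∀ (p : u.P) (a : A), (∃ q, p < q ∧ u.w q = a) →
    ∃ q, p < q ∧ u.w q = a ∧ ∀ r, p < r → u.w r = a → q ≤ r) ∧
  (∀ (p : u.P) (a : A), (∃ q, q < p ∧ u.w q = a) →
    ∃ q, q < p ∧ u.w q = a ∧ ∀ r, r < p → u.w r = a → r ≤ q)

/-- Concatenation of generalized words. -/
def append (u v : GWord A) : GWord A :=
  ⟨u.P ⊕ₗ v.P, inferInstance, fun x => Sum.elim u.w v.w (ofLex x)⟩

/-- The power of a generalized word by an arbitrary linear order type `ν`
(positions ordered with the exponent component dominant). -/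
def gpow (u : GWord A) (ν : Type) [LinearOrder ν] : GWord A :=
  ⟨ν ×ₗ u.P, inferInstance, fun x => u.w (ofLex x).2⟩

/-- A finite word as a generalized word. -/
def ofList (l : List A) : GWord A :=
  ⟨Fin l.length, inferInstance, fun i => l.get i⟩

end GWord

/-- The order type `ω + ω*`: a copy of `ℕ` followed by a reversed copy of `ℕ`. -/
abbrev OO : Type := ℕ ⊕ₗ ℕᵒᵈ

/-! ## The relations `≡_{m,n}^Z` -/

inductive ZK : Type
  | X | Y | WI

inductive ZKind : Type
  | X | Y | XY | WI

/-- The relations `≡_{m,n}^X`, `≡_{m,n}^Y`, `≡_{m,n}^{WI}` (first argument is `n`). -/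
def eqvAux {A : Type} : ℕ → ZK → ℕ → GWord A → GWord A → Prop
  | 0, _, _, _, _ => True
  | _ + 1, _, 0, _, _ => True
  | n + 1, ZK.X, m + 1, u, v =>
      u.alph = v.alph ∧ eqvAux n ZK.Y m u v ∧
      ∀ a ∈ u.alph, eqvAux n ZK.Y m (u.XL a) (v.XL a) ∧
        eqvAux n ZK.X (m + 1) (u.XR a) (v.XR a)
  | n + 1, ZK.Y, m + 1, u, v =>
      u.alph = v.alph ∧ eqvAux n ZK.X m u v ∧
      ∀ a ∈ u.alph, eqvAux n ZK.Y (m + 1) (u.YL a) (v.YL a) ∧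
        eqvAux n ZK.X m (u.YR a) (v.YR a)
  | n + 1, ZK.WI, m + 1, u, v =>
      u.alph = v.alph ∧
      (∀ a ∈ u.alph,
        eqvAux n ZK.WI m (u.XL a) (v.XL a) ∧ eqvAux n ZK.WI (m + 1) (u.XR a) (v.XR a) ∧
        eqvAux n ZK.WI (m + 1) (u.YL a) (v.YL a) ∧ eqvAux n ZK.WI m (u.YR a) (v.YR a)) ∧
      ∀ a ∈ u.alph, ∀ b ∈ u.alph,
        (u.CDefined a b ↔ v.CDefined a b) ∧
        (u.CDefined a b → v.CDefined a b → eqvAux n ZK.WI m (u.Cab a b) (v.Cab a b))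

/-- `wEquiv Z m n u v` is `u ≡_{m,n}^Z v`. -/
def wEquiv {A : Type} (Z : ZKind) (m n : ℕ) (u v : GWord A) : Prop :=
  match Z with
  | ZKind.X => eqvAux n ZK.X m u v
  | ZKind.Y => eqvAux n ZK.Y m u v
  | ZKind.XY => eqvAux n ZK.X m u v ∧ eqvAux n ZK.Y m u v
  | ZKind.WI => eqvAux n ZK.WI m u v

/-! ## π-terms -/

inductive PiTerm (A : Type) : Type
  | eps : PiTerm A
  | letter : A → PiTerm A
  | mul : PiTerm A → PiTerm A → PiTerm A
  | pi : PiTerm A → PiTerm A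

def listNPow {A : Type} (l : List A) : ℕ → List A
  | 0 => []
  | k + 1 => l ++ listNPow l k

/-- `[γ]_k`: substitute the natural number `k` for the formal power `π`. -/
def PiTerm.substNat {A : Type} : PiTerm A → ℕ → List A
  | .eps, _ => []
  | .letter a, _ => [a]
  | .mul α β, k => α.substNat k ++ β.substNat k
  | .pi γ, k => listNPow (γ.substNat k) k

/-- `[γ]_{ω+ω*}`: substitute the order type `ω + ω*` for the formal power `π`. -/
def PiTerm.substOO {A : Type} : PiTerm A → GWord A
  | .eps => GWord.ofList []
  | .letter a => GWord.ofList [a]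
  | .mul α β => α.substOO.append β.substOO
  | .pi γ => γ.substOO.gpow OO

/-! ## Finite monoids, equations, the Trotter–Weil hierarchy -/

/-- `M!`: the exponent of a finite monoid, the least `n ≥ 1` such that all `x^n` are
idempotent. -/
noncomputable def monoidExp (M : Type) [Monoid M] : ℕ :=
  sInf {n : ℕ | 1 ≤ n ∧ ∀ x : M, IsIdempotentElem (x ^ n)}

/-- The equation `α = β` of π-terms holds in the finite monoid `M`. -/
def EqHoldsIn {A : Type} (α β : PiTerm A) (M : Type) [Monoid M] : Prop :=
  ∀ σ : FreeMonoid A →* M,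
    σ (FreeMonoid.ofList (α.substNat (monoidExp M))) =
      σ (FreeMonoid.ofList (β.substNat (monoidExp M)))

/-- Green's relation `R`: `x R y` iff `xM = yM`. -/
def rGreen {M : Type} [Monoid M] (x y : M) : Prop :=
  Set.range (fun z => x * z) = Set.range (fun z => y * z)

/-- Green's relation `L`: `x L y` iff `Mx = My`. -/
def lGreen {M : Type} [Monoid M] (x y : M) : Prop :=
  Set.range (fun z => z * x) = Set.range (fun z => z * y)

/-- `J`-triviality: `MxM = MyM` implies `x = y`. -/
def IsJTrivial (M : Type) [Monoid M] : Prop :=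
  ∀ x y : M, {z | ∃ a b, z = a * x * b} = {z | ∃ a b, z = a * y * b} → x = y

/-- The relation `∼_K`. -/
def simK {M : Type} [Monoid M] (x y : M) : Prop :=
  ∀ e : M, IsIdempotentElem e → (rGreen (e * x) e ∨ rGreen (e * y) e) → e * x = e * y

/-- The relation `∼_D`. -/
def simD {M : Type} [Monoid M] (x y : M) : Prop :=
  ∀ e : M, IsIdempotentElem e → (lGreen (x * e) e ∨ lGreen (y * e) e) → x * e = y * e

/-- `∼_K` as a congruence (it is a congruence, so `conGen` does not change it). -/
def KCon (M : Type) [Monoid M] : Con M := conGen simK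

/-- `∼_D` as a congruence. -/
def DCon (M : Type) [Monoid M] : Con M := conGen simD

/-- `InRLAux k true M _ = (M ∈ R_{k+1})` and `InRLAux k false M _ = (M ∈ L_{k+1})`. -/
def InRLAux : ℕ → Bool → (M : Type) → Monoid M → Prop
  | 0, _, M, i => letI := i; IsJTrivial M
  | k + 1, true, M, i => letI := i; InRLAux k false (KCon M).Quotient inferInstance
  | k + 1, false, M, i => letI := i; InRLAux k true (DCon M).Quotient inferInstance

/-- `M ∈ R_m` (for `m ≥ 1`). -/
def InRm (m : ℕ) (M : Type) [i : Monoid M] : Prop := InRLAux (m - 1) true M i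

/-- `M ∈ L_m` (for `m ≥ 1`). -/
def InLm (m : ℕ) (M : Type) [i : Monoid M] : Prop := InRLAux (m - 1) false M i

/-- `N` divides `M`: `N` is a homomorphic image of a submonoid of `M`. -/
def MDivides (N M : Type) [Monoid N] [Monoid M] : Prop :=
  ∃ (S : Submonoid M) (f : S →* N), Function.Surjective f

/-- `N ∈ R_m ∨ L_m`: `N` divides a direct product `M₁ × M₂` with `M₁ ∈ R_m`, `M₂ ∈ L_m`. -/
def InJoin (m : ℕ) (N : Type) [Monoid N] : Prop :=
  ∃ (M₁ M₂ : Type) (i₁ : Monoid M₁) (i₂ : Monoid M₂),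
    letI := i₁; letI := i₂;
    Finite M₁ ∧ Finite M₂ ∧ InRm m M₁ ∧ InLm m M₂ ∧ MDivides N (M₁ × M₂)

/-- `M ∈ DA`, via the equation `(xyz)^{M!} y (xyz)^{M!} = (xyz)^{M!}`. -/
def InDA (M : Type) [Monoid M] : Prop :=
  ∀ x y z : M,
    (x * y * z) ^ monoidExp M * y * (x * y * z) ^ monoidExp M = (x * y * z) ^ monoidExp M

/-! ## The π-terms `U_m`, `V_m` -/

inductive UVLetter : Type
  | s | t | x (i : ℕ) | y (i : ℕ)

/-- `U_m` (indexed from 1; `Uterm 0` is a junk value). -/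
def Uterm : ℕ → PiTerm UVLetter
  | 0 => PiTerm.eps
  | 1 =>
      PiTerm.mul
        (PiTerm.pi (PiTerm.mul (PiTerm.letter UVLetter.s) (PiTerm.letter (UVLetter.x 1))))
        (PiTerm.mul (PiTerm.letter UVLetter.s)
          (PiTerm.pi (PiTerm.mul (PiTerm.letter (UVLetter.y 1)) (PiTerm.letter UVLetter.t))))
  | m + 2 =>
      PiTerm.mul
        (PiTerm.pi (PiTerm.mul (Uterm (m + 1)) (PiTerm.letter (UVLetter.x (m + 2)))))
        (PiTerm.mul (Uterm (m + 1))
          (PiTerm.pi (PiTerm.mul (PiTerm.letter (UVLetter.y (m + 2))) (Uterm (m + 1)))))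

/-- `V_m` (indexed from 1; `Vterm 0` is a junk value). -/
def Vterm : ℕ → PiTerm UVLetter
  | 0 => PiTerm.eps
  | 1 =>
      PiTerm.mul
        (PiTerm.pi (PiTerm.mul (PiTerm.letter UVLetter.s) (PiTerm.letter (UVLetter.x 1))))
        (PiTerm.mul (PiTerm.letter UVLetter.t)
          (PiTerm.pi (PiTerm.mul (PiTerm.letter (UVLetter.y 1)) (PiTerm.letter UVLetter.t))))
  | m + 2 =>
      PiTerm.mul
        (PiTerm.pi (PiTerm.mul (Uterm (m + 1)) (PiTerm.letter (UVLetter.x (m + 2)))))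
        (PiTerm.mul (Vterm (m + 1))
          (PiTerm.pi (PiTerm.mul (PiTerm.letter (UVLetter.y (m + 2))) (Uterm (m + 1)))))

/-- The relation `≡_{m,n}^Z` on the free monoid `Σ*`, as a congruence
(it is a congruence, so `conGen` does not change it). -/
def eqvCon (A : Type) (Z : ZKind) (m n : ℕ) : Con (FreeMonoid A) :=
  conGen (fun u v => wEquiv Z m n (GWord.ofList u.toList) (GWord.ofList v.toList))

theorem rGreen_mul_iff {M : Type} [Monoid M] {s x : M} :
    rGreen s (s * x) ↔ ∃ z, s * x * z = s := by
  constructor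
  · intro h
    have hs : s ∈ Set.range (fun z => s * z) := ⟨1, mul_one s⟩
    rw [h] at hs
    exact hs
  · rintro ⟨z, hz⟩
    ext t
    constructor
    · rintro ⟨w, rfl⟩
      exact ⟨z * w, by simp only [← mul_assoc, hz]⟩
    · rintro ⟨w, rfl⟩
      exact ⟨x * w, by simp only [mul_assoc]⟩

theorem mul_pow_eq_of_mul_eq {M : Type} [Monoid M] {s w : M} (h : s * w = s) (n : ℕ) :
    s * w ^ n = s := by
  induction n with
  | zero => simp
  | succ n ih => rw [pow_succ, ← mul_assoc, ih, h]

/-- In a monoid in `DA`, a factor `y` of a right stabilizer of `s` can be undone from `s * y`. -/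
theorem InDA.mul_mul_pow_eq {M : Type} [Monoid M] (hM : InDA M) {s x y z : M}
    (h : s * (x * y * z) = s) : s * y * (x * y * z) ^ monoidExp M = s := by
  have hs := mul_pow_eq_of_mul_eq h (monoidExp M)
  calc s * y * (x * y * z) ^ monoidExp M
      = s * (x * y * z) ^ monoidExp M * y * (x * y * z) ^ monoidExp M := by rw [hs]
    _ = s * ((x * y * z) ^ monoidExp M * y * (x * y * z) ^ monoidExp M) := by
        simp only [mul_assoc]
    _ = s := by rw [hM, hs]

/-- If some right multiple `c * m` of `c` stabilizes `s`, then multiplying `s` by a factor of `c`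
keeps this property and stays in the `R`-class of `s`. -/
theorem InDA.exists_mul_eq_of_factor {M : Type} [Monoid M] (hM : InDA M) {s c x y z : M}
    (hc : c = x * y * z) (h : ∃ m, s * c * m = s) :
    (∃ m, s * y * c * m = s * y) ∧ ∃ m, s * y * m = s := by
  obtain ⟨m, hm⟩ := h
  have hw : x * y * (z * m) = c * m := by rw [hc]; simp only [mul_assoc]
  have hs : s * y * (c * m) ^ monoidExp M = s := by
    rw [← hw]
    exact hM.mul_mul_pow_eq (by rw [hw, ← mul_assoc, hm])
  refine ⟨?_, _, hs⟩
  rcases hN : monoidExp M with _ | n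
  · have hone : ∀ t : M, t = 1 := fun t => by simpa [hN] using hM 1 t 1
    exact ⟨1, (hone _).trans (hone _).symm⟩
  · refine ⟨m * (c * m) ^ n * y, ?_⟩
    calc s * y * c * (m * (c * m) ^ n * y)
        = s * y * (c * m) ^ (n + 1) * y := by rw [pow_succ']; simp only [mul_assoc]
      _ = s * y := by rw [← hN, hs]

/-- Lemma: in DA, staying in the same R-class only depends on the alphabet of the word. -/
theorem rDescend_in_DA_words (A : Type) [Fintype A] (M : Type) [Monoid M] [Finite M]
    (hM : InDA M) (s : M) (φ : FreeMonoid A →* M) (u v : List A)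
    (halph : {a | a ∈ u} = {a | a ∈ v})
    (h : rGreen s (s * φ (FreeMonoid.ofList u))) :
    rGreen s (s * φ (FreeMonoid.ofList v)) := by
  rw [rGreen_mul_iff] at h ⊢
  have hvu : ∀ a ∈ v, a ∈ u := fun a ha => halph.ge ha
  clear halph
  induction v generalizing s with
  | nil => exact ⟨1, by simp⟩
  | cons a v ih =>
    obtain ⟨p, q, hpq⟩ := List.append_of_mem (hvu a List.mem_cons_self)
    have hu : φ (FreeMonoid.ofList u) =
        φ (FreeMonoid.ofList p) * φ (FreeMonoid.of a) * φ (FreeMonoid.ofList q) := by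
      rw [hpq, FreeMonoid.ofList_append, FreeMonoid.ofList_cons, map_mul, map_mul, mul_assoc]
    obtain ⟨hstab, m, hm⟩ := hM.exists_mul_eq_of_factor hu h
    obtain ⟨z, hz⟩ := ih _ hstab fun b hb => hvu b (List.mem_cons_of_mem a hb)
    refine ⟨z * m, ?_⟩
    rw [FreeMonoid.ofList_cons, map_mul, ← mul_assoc, ← mul_assoc, hz, hm]
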